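/- Let d ∈ N, let w : Z^d → (0,∞) be a weight with ∑_{k∈Z^d} w(k)^{-2} < ∞, and fix ψ as in the context. Then for every n ∈ N: a_n(I_d : F_d(w) → B^0_{∞,1}(T^d)) = a_n(I_d : F_d(w) → L∞(T^d)) = a_n(I_d : F_d(w) → C(T^d)) = a_n(I_d : F_d(w) → A(T^d)). -/

import Mathlib

open MeasureTheory Filter
open scoped ENNReal NNReal

noncomputable section

/-- The index lattice `ℤ^d`. -/
abbrev ZLat (d : ℕ) := Fin d → ℤ

instance fact_two_pi_pos : Fact (0 < 2 * Real.pi) := ⟨by positivity⟩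

/-- The `d`-dimensional torus `𝕋^d = [0,2π]^d` with endpoints identified. -/
abbrev Torus (d : ℕ) := Fin d → AddCircle (2 * Real.pi)

/-- The normalized Lebesgue measure `(2π)^{-d} dx` on the `d`-torus. -/
def torusMeasure (d : ℕ) : Measure (Torus d) :=
  ((ENNReal.ofReal (2 * Real.pi))⁻¹) ^ d • Measure.pi fun _ => volume

/-- The character `e^{i k·x}` on the `d`-torus. -/
def torusChar {d : ℕ} (k : ZLat d) (x : Torus d) : ℂ :=
  ∏ j, fourier (k j) (x j)

/-- The `k`-th Fourier coefficient `f̂(k) = (2π)^{-d} ∫_{𝕋^d} f(x) e^{-i k·x} dx`. -/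
def fourierCoef {d : ℕ} (f : Torus d → ℂ) (k : ZLat d) : ℂ :=
  ∫ x, (starRingEnd ℂ) (torusChar k x) * f x ∂(torusMeasure d)

/-- The `n`-th approximation number of a bounded linear operator `T`:
`a_n(T) = inf {‖T - A‖ : rank A < n}`. -/
def approxNum {X Y : Type*} [NormedAddCommGroup X] [NormedSpace ℂ X]
    [NormedAddCommGroup Y] [NormedSpace ℂ Y] (T : X →L[ℂ] Y) (n : ℕ) : ℝ :=
  sInf {c : ℝ | ∃ A : X →L[ℂ] Y,
    Module.rank ℂ (LinearMap.range (A : X →ₗ[ℂ] Y)) < n ∧ c = ‖T - A‖}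

/-- `ℓ²(ℤ^d)`; an isometric model of the Hilbert space `F_d(w)` via `f ↦ (w(k)·f̂(k))_k`.
Under this identification the embedding `I_d : F_d(w) → G` is characterized by the
property that the function `T c` has Fourier coefficients `c(k)/w(k)`. -/
abbrev ellTwo (d : ℕ) := lp (fun _ : ZLat d => ℂ) 2

/-- `ℓ¹(ℤ^d)`; an isometric model of the Wiener algebra `A(𝕋^d)` via `f ↦ (f̂(k))_k`. -/
abbrev ellOne (d : ℕ) := lp (fun _ : ZLat d => ℂ) 1

/-- `ℓ^∞(ℤ^d)`; an isometric model of the space `ℬ(𝕋^d)` of distributions with bounded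
Fourier coefficients. -/
abbrev ellInfty (d : ℕ) := lp (fun _ : ZLat d => ℂ) ⊤

/-- The smooth dyadic decomposition of unity `(φ_j)_{j≥0}` on `ℝ^d` generated by `ψ`:
`φ_0 = ψ` and `φ_j(ξ) = ψ(2^{-j}ξ) - ψ(2^{-j+1}ξ)` for `j ≥ 1`. -/
def dyadicPhi {d : ℕ} (ψ : (Fin d → ℝ) → ℝ) : ℕ → (Fin d → ℝ) → ℝ
  | 0 => ψ
  | j + 1 => fun ξ => ψ (((2 : ℝ)⁻¹ ^ (j + 1)) • ξ) - ψ (((2 : ℝ)⁻¹ ^ j) • ξ)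

/-- The `j`-th dyadic block `f_j(x) = ∑_k φ_j(k) f̂(k) e^{i k·x}` of a function on the
`d`-torus. -/
def dyadicBlock {d : ℕ} (ψ : (Fin d → ℝ) → ℝ) (f : Torus d → ℂ) (j : ℕ)
    (x : Torus d) : ℂ :=
  ∑' k : ZLat d,
    ((dyadicPhi ψ j fun i => (k i : ℝ)) : ℂ) * fourierCoef f k * torusChar k x


lemma torusMeasure_eq_pi (d : ℕ) :
    torusMeasure d = Measure.pi fun _ : Fin d => (AddCircle.haarAddCircle (T := 2 * Real.pi)) := by
  symm
  refine Measure.pi_eq fun s _ => ?_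
  have h0 : ENNReal.ofReal (2 * Real.pi) ≠ 0 := by
    simp [Real.pi_pos]
  have hvol : ∀ t : Set (AddCircle (2 * Real.pi)), (AddCircle.haarAddCircle (T := 2 * Real.pi)) t =
      (ENNReal.ofReal (2 * Real.pi))⁻¹ * volume t := by
    intro t
    rw [AddCircle.volume_eq_smul_haarAddCircle, Measure.smul_apply, smul_eq_mul, ← mul_assoc,
      ENNReal.inv_mul_cancel h0 ENNReal.ofReal_ne_top, one_mul]
  rw [torusMeasure, Measure.smul_apply, Measure.pi_pi]
  simp [hvol, Finset.prod_mul_distrib]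

instance isProbabilityMeasure_torusMeasure (d : ℕ) : IsProbabilityMeasure (torusMeasure d) := by
  rw [torusMeasure_eq_pi]; infer_instance

instance isOpenPosMeasure_torusMeasure (d : ℕ) : (torusMeasure d).IsOpenPosMeasure := by
  rw [torusMeasure_eq_pi]; infer_instance

/-- The character `e^{i k·x}` as a continuous function. -/
def torusCharCM {d : ℕ} (k : ZLat d) : C(Torus d, ℂ) where
  toFun := torusChar k
  continuous_toFun := by unfold torusChar; fun_prop

lemma norm_torusChar {d : ℕ} (k : ZLat d) (x : Torus d) : ‖torusChar k x‖ = 1 := by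
  simp only [torusChar, norm_prod, fourier_apply, Circle.norm_coe, Finset.prod_const_one]

lemma torusChar_neg {d : ℕ} (k : ZLat d) (x : Torus d) :
    torusChar (-k) x = (starRingEnd ℂ) (torusChar k x) := by
  simp only [torusChar, Pi.neg_apply, fourier_neg, map_prod]

lemma torusChar_add {d : ℕ} (k l : ZLat d) (x : Torus d) :
    torusChar (k + l) x = torusChar k x * torusChar l x := by
  simp only [torusChar, Pi.add_apply, fourier_add, Finset.prod_mul_distrib]

lemma torusChar_zero {d : ℕ} (x : Torus d) : torusChar (0 : ZLat d) x = 1 := by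
  simp [torusChar]

lemma fourierCoef_torusChar {d : ℕ} (k l : ZLat d) :
    fourierCoef (torusChar l) k = if k = l then 1 else 0 := by
  simp only [fourierCoef, ← torusChar_neg, ← torusChar_add]
  split_ifs with h
  · simp [h, torusChar_zero]
  · rw [add_comm]
    simp only [torusChar, torusMeasure_eq_pi]
    rw [integral_fintype_prod_eq_prod (fun j (x : AddCircle (2 * Real.pi)) =>
      fourier ((l + -k) j) x)]
    obtain ⟨i, hi⟩ := Function.ne_iff.mp h
    apply Finset.prod_eq_zero (Finset.mem_univ i)
    simpa only [eq_false_intro hi, if_false, ContinuousMap.inner_toLp, ← fourier_neg,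
      ← fourier_add] using!
      (orthonormal_iff_ite.mp <| orthonormal_fourier (T := 2 * Real.pi)) (k i) (l i)

/-- The star subalgebra of `C(𝕋^d)` generated by the characters. -/
def torusCharSubalgebra (d : ℕ) : StarSubalgebra ℂ C(Torus d, ℂ) where
  toSubalgebra := Algebra.adjoin ℂ (Set.range torusCharCM)
  star_mem' := by
    change Algebra.adjoin ℂ (Set.range torusCharCM) ≤
      star (Algebra.adjoin ℂ (Set.range torusCharCM))
    refine Algebra.adjoin_le ?_
    rintro _ ⟨n, rfl⟩
    refine Algebra.subset_adjoin ⟨-n, ?_⟩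
    ext1 x
    exact torusChar_neg n x

lemma torusCharSubalgebra_coe (d : ℕ) :
    (torusCharSubalgebra d).toSubalgebra.toSubmodule =
      Submodule.span ℂ (Set.range torusCharCM) := by
  apply Algebra.adjoin_eq_span_of_subset
  refine .trans (fun x => Submonoid.closure_induction (fun _ => id) ⟨0, ?_⟩ ?_)
    Submodule.subset_span
  · ext x
    exact torusChar_zero x
  · rintro _ _ _ _ ⟨m, rfl⟩ ⟨n, rfl⟩
    refine ⟨m + n, ?_⟩
    ext x
    exact torusChar_add m n x

lemma torusCharSubalgebra_separatesPoints (d : ℕ) :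
    (torusCharSubalgebra d).SeparatesPoints := by
  classical
  intro x y hxy
  obtain ⟨i, hi⟩ := Function.ne_iff.mp hxy
  have hsingle : ∀ z : Torus d, torusChar (Pi.single i 1) z = fourier 1 (z i) := by
    intro z
    rw [torusChar, Finset.prod_eq_single i]
    · simp
    · intro j _ hj
      simp [Pi.single_eq_of_ne hj]
    · simp
  refine ⟨_, ⟨torusCharCM (Pi.single i 1), Algebra.subset_adjoin ⟨Pi.single i 1, rfl⟩, rfl⟩, ?_⟩
  change torusChar (Pi.single i 1) x ≠ torusChar (Pi.single i 1) y
  rw [hsingle, hsingle, fourier_one, fourier_one, Ne]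
  exact fun he => hi (AddCircle.injective_toCircle (by positivity) (Circle.ext he))

lemma span_torusCharCM_closure_eq_top (d : ℕ) :
    (Submodule.span ℂ (Set.range (torusCharCM (d := d)))).topologicalClosure = ⊤ := by
  rw [← torusCharSubalgebra_coe]
  exact congr_arg (Subalgebra.toSubmodule <| StarSubalgebra.toSubalgebra ·)
    (ContinuousMap.starSubalgebra_topologicalClosure_eq_top_of_separatesPoints _
      (torusCharSubalgebra_separatesPoints d))

/-- The characters as elements of `L²`. -/
abbrev torusCharLp {d : ℕ} (k : ZLat d) : Lp ℂ 2 (torusMeasure d) :=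
  ContinuousMap.toLp (E := ℂ) 2 (torusMeasure d) ℂ (torusCharCM k)

lemma inner_torusCharLp {d : ℕ} (k : ZLat d) {f : Torus d → ℂ} (hf : MemLp f 2 (torusMeasure d)) :
    inner ℂ (torusCharLp k) (hf.toLp f) = fourierCoef f k := by
  rw [L2.inner_def, fourierCoef]
  refine integral_congr_ae ?_
  filter_upwards [hf.coeFn_toLp,
    ContinuousMap.coeFn_toLp (p := 2) (𝕜 := ℂ) (torusMeasure d) (torusCharCM k)] with x h1 h2
  rw [h1, h2, RCLike.inner_apply, mul_comm]
  rfl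

lemma memLp_of_continuous {d : ℕ} (f : C(Torus d, ℂ)) (p : ℝ≥0∞) :
    MemLp f p (torusMeasure d) :=
  (f.continuous.memLp_of_hasCompactSupport (HasCompactSupport.of_compactSpace _))

lemma orthonormal_torusCharLp (d : ℕ) : Orthonormal ℂ (torusCharLp (d := d)) := by
  rw [orthonormal_iff_ite]
  intro k l
  exact (inner_torusCharLp k (memLp_of_continuous (torusCharCM l) 2)).trans
    (fourierCoef_torusChar k l)

lemma ae_eq_of_fourierCoef_eq {d : ℕ} {f g : Torus d → ℂ} (hf : MemLp f 2 (torusMeasure d))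
    (hg : MemLp g 2 (torusMeasure d)) (h : ∀ k, fourierCoef f k = fourierCoef g k) :
    f =ᵐ[torusMeasure d] g := by
  have hd : (Submodule.span ℂ (Set.range (torusCharLp (d := d)))).topologicalClosure = ⊤ := by
    have := (ContinuousMap.toLp_denseRange ℂ (torusMeasure d) ℂ
      (p := 2) (by simp)).topologicalClosure_map_submodule (span_torusCharCM_closure_eq_top d)
    simpa only [Submodule.map_span, ContinuousLinearMap.coe_coe, ← Set.range_comp,
      Function.comp_def] using this
  have hfg : hf.toLp f = hg.toLp g := by
    refine (Submodule.dense_iff_topologicalClosure_eq_top.2 hd).eq_of_inner_right ℂ ?_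
    intro v hv
    refine Submodule.span_induction (p := fun v _ => inner ℂ v (hf.toLp f) = inner ℂ v (hg.toLp g))
      ?_ ?_ ?_ ?_ hv
    · rintro _ ⟨k, rfl⟩
      rw [inner_torusCharLp, inner_torusCharLp, h]
    · simp
    · intro x y _ _ hx hy
      rw [inner_add_left, inner_add_left, hx, hy]
    · intro a x _ hx
      rw [inner_smul_left, inner_smul_left, hx]
  exact (MemLp.toLp_eq_toLp_iff hf hg).1 hfg

lemma sum_norm_fourierCoef_sq_le {d : ℕ} {f : Torus d → ℂ} (hf : MemLp f 2 (torusMeasure d))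
    (s : Finset (ZLat d)) :
    ∑ k ∈ s, ‖fourierCoef f k‖ ^ 2 ≤ ∫ x, ‖f x‖ ^ 2 ∂(torusMeasure d) := by
  have h := (orthonormal_torusCharLp d).sum_inner_products_le (x := hf.toLp f) (s := s)
  simp only [inner_torusCharLp] at h
  refine h.trans_eq ?_
  rw [← @inner_self_eq_norm_sq ℂ, L2.inner_def, ← integral_re (L2.integrable_inner _ _)]
  refine integral_congr_ae ?_
  filter_upwards [hf.coeFn_toLp] with x hx
  rw [hx]
  exact inner_self_eq_norm_sq (𝕜 := ℂ) (f x)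

/-- The `k`-th Fourier coefficient as a continuous linear functional on `C(𝕋^d)`. -/
def fourierCoefCLM {d : ℕ} (k : ZLat d) : C(Torus d, ℂ) →L[ℂ] ℂ :=
  (innerSL ℂ (torusCharLp k)).comp (ContinuousMap.toLp (E := ℂ) 2 (torusMeasure d) ℂ)

lemma fourierCoefCLM_apply {d : ℕ} (k : ZLat d) (f : C(Torus d, ℂ)) :
    fourierCoefCLM k f = fourierCoef f k :=
  inner_torusCharLp k (memLp_of_continuous f 2)

lemma norm_torusCharCM_le {d : ℕ} (k : ZLat d) : ‖torusCharCM k‖ ≤ 1 :=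
  (ContinuousMap.norm_le _ zero_le_one).2 fun x => (norm_torusChar k x).le

lemma continuousMap_eq_of_fourierCoef_eq {d : ℕ} {f g : C(Torus d, ℂ)}
    (h : ∀ k, fourierCoef f k = fourierCoef g k) : f = g :=
  DFunLike.coe_injective ((f.continuous.ae_eq_iff_eq (torusMeasure d) g.continuous).1
    (ae_eq_of_fourierCoef_eq (memLp_of_continuous f 2) (memLp_of_continuous g 2) h))

/-- A function with absolutely summable Fourier coefficients agrees almost everywhere with a
continuous function bounded by the sum of the absolute values of the coefficients. -/
lemma exists_continuous_ae_eq {d : ℕ} {f : Torus d → ℂ} (hf : MemLp f 2 (torusMeasure d))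
    (hs : Summable fun k => ‖fourierCoef f k‖) :
    ∃ g : C(Torus d, ℂ), f =ᵐ[torusMeasure d] g ∧ ‖g‖ ≤ ∑' k, ‖fourierCoef f k‖ := by
  have hle : ∀ k, ‖fourierCoef f k • torusCharCM k‖ ≤ ‖fourierCoef f k‖ := fun k => by
    rw [norm_smul]
    exact mul_le_of_le_one_right (norm_nonneg _) (norm_torusCharCM_le k)
  have hsum : Summable fun k => fourierCoef f k • torusCharCM k := .of_norm_bounded hs hle
  refine ⟨∑' k, fourierCoef f k • torusCharCM k, ?_, tsum_of_norm_bounded hs.hasSum hle⟩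
  refine ae_eq_of_fourierCoef_eq hf (memLp_of_continuous _ 2) fun k => ?_
  rw [← fourierCoefCLM_apply, ContinuousLinearMap.map_tsum _ hsum, tsum_eq_single k]
  · rw [map_smul, fourierCoefCLM_apply]
    change _ = _ • fourierCoef (torusChar k) k
    simp [fourierCoef_torusChar]
  · intro l hl
    rw [map_smul, fourierCoefCLM_apply]
    change _ • fourierCoef (torusChar l) k = 0
    simp [fourierCoef_torusChar, hl.symm]

lemma norm_le_tsum_norm_fourierCoef {d : ℕ} {f : C(Torus d, ℂ)}
    (hs : Summable fun k => ‖fourierCoef f k‖) : ‖f‖ ≤ ∑' k, ‖fourierCoef f k‖ := by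
  obtain ⟨g, hfg, hg⟩ := exists_continuous_ae_eq (memLp_of_continuous f 2) hs
  obtain rfl : f = g :=
    DFunLike.coe_injective ((f.continuous.ae_eq_iff_eq (torusMeasure d) g.continuous).1 hfg)
  exact hg

lemma Lp_norm_le_tsum_norm_fourierCoef {d : ℕ} {f : Lp ℂ ⊤ (torusMeasure d)}
    (hs : Summable fun k => ‖fourierCoef f k‖) : ‖f‖ ≤ ∑' k, ‖fourierCoef f k‖ := by
  obtain ⟨g, hfg, hg⟩ := exists_continuous_ae_eq ((Lp.memLp f).mono_exponent le_top) hs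
  have h0 : 0 ≤ ∑' k, ‖fourierCoef f k‖ := tsum_nonneg fun _ => norm_nonneg _
  refine (Lp.norm_le_of_ae_bound (C := ∑' k, ‖fourierCoef f k‖) h0 ?_).trans ?_
  · filter_upwards [hfg] with x hx
    rw [hx]
    exact (g.norm_coe_le_norm x).trans hg
  · simp

/-- A bounded operator from a Euclidean space into `L^∞` of a probability measure is
Hilbert–Schmidt as an operator into `L²`, with norm bounded by the operator norm. -/
lemma sum_integral_norm_sq_le {α ι : Type*} [MeasurableSpace α] {μ : Measure α}
    [IsProbabilityMeasure μ] (s : Finset ι) (g : ι → Lp ℂ ⊤ μ) {C : ℝ}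
    (h : ∀ c : ι → ℂ, ‖∑ k ∈ s, c k • g k‖ ≤ C * √(∑ k ∈ s, ‖c k‖ ^ 2)) :
    ∑ k ∈ s, ∫ x, ‖g k x‖ ^ 2 ∂μ ≤ C ^ 2 := by
  classical
  have hsumcoe : ∀ c : ι → ℂ, ∀ᵐ x ∂μ,
      (∑ k ∈ s, c k • g k : Lp ℂ ⊤ μ) x = ∑ k ∈ s, c k * g k x := by
    intro c
    clear h
    induction s using Finset.induction_on with
    | empty => exact Lp.coeFn_zero ℂ ⊤ μ
    | insert a s ha ih =>
      simp only [Finset.sum_insert ha]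
      filter_upwards [Lp.coeFn_add (c a • g a) (∑ k ∈ s, c k • g k),
        Lp.coeFn_smul (c a) (g a), ih] with x h1 h2 h3
      rw [h1, Pi.add_apply, h2, Pi.smul_apply, h3, smul_eq_mul]
  have hpt : ∀ᵐ x ∂μ, ∀ c : s → ℂ,
      ‖∑ k, c k * g k x‖ ≤ C * √(∑ k, ‖c k‖ ^ 2) := by
    have hdense : ∀ᵐ x ∂μ, ∀ n : ℕ,
        ‖∑ k, TopologicalSpace.denseSeq (s → ℂ) n k * g k x‖ ≤
          C * √(∑ k, ‖TopologicalSpace.denseSeq (s → ℂ) n k‖ ^ 2) := by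
      rw [ae_all_iff]
      intro n
      set c := TopologicalSpace.denseSeq (s → ℂ) n with hc
      let c' : ι → ℂ := fun k => if hk : k ∈ s then c ⟨k, hk⟩ else 0
      have hc' : ∀ k : s, c' k = c k := fun k => by simp [c']
      filter_upwards [hsumcoe c', ae_le_eLpNormEssSup (f := (∑ k ∈ s, c' k • g k : Lp ℂ ⊤ μ))]
        with x h1 h2
      have h3 : ‖(∑ k ∈ s, c' k • g k : Lp ℂ ⊤ μ) x‖ ≤ ‖∑ k ∈ s, c' k • g k‖ := by
        have h5 := ENNReal.toReal_mono (Lp.eLpNorm_ne_top _) (h2.trans_eq eLpNorm_exponent_top.symm)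
        simpa [Lp.norm_def] using h5
      have h4 := h3.trans (h c')
      rw [h1, ← Finset.sum_coe_sort s, ← Finset.sum_coe_sort s] at h4
      simpa only [hc'] using h4
    filter_upwards [hdense] with x hx c
    have hcl : IsClosed {c : s → ℂ | ‖∑ k, c k * g k x‖ ≤ C * √(∑ k, ‖c k‖ ^ 2)} :=
      isClosed_le (by fun_prop) (by fun_prop)
    exact hcl.closure_subset_iff.2 (Set.range_subset_iff.2 hx)
      (TopologicalSpace.denseRange_denseSeq (s → ℂ) c)
  have hint : ∀ k, Integrable (fun x => ‖g k x‖ ^ 2) μ := fun k =>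
    ((Lp.memLp (g k)).mono_exponent le_top).integrable_norm_pow (by simp)
  rw [← integral_finsetSum _ fun k _ => hint k]
  calc _ ≤ ∫ _, C ^ 2 ∂μ := by
        refine integral_mono_ae (integrable_finsetSum _ fun k _ => hint k)
          (integrable_const _) ?_
        filter_upwards [hpt] with x hx
        have h1 := hx fun k => (starRingEnd ℂ) (g k x)
        have hS : 0 ≤ ∑ k ∈ s, ‖g k x‖ ^ 2 := Finset.sum_nonneg fun _ _ => sq_nonneg _
        have h2 : ‖∑ k : s, (starRingEnd ℂ) (g k x) * g k x‖ = ∑ k ∈ s, ‖g k x‖ ^ 2 := by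
          simp_rw [Complex.conj_mul']
          rw [Finset.sum_coe_sort s (fun k => ((‖g k x‖ : ℂ)) ^ 2)]
          rw [← abs_of_nonneg hS, ← Real.norm_eq_abs, ← Complex.norm_real]
          push_cast
          rfl
        simp only [RCLike.norm_conj] at h1
        rw [h2, Finset.sum_coe_sort s (fun k => ‖g k x‖ ^ 2)] at h1
        set S := ∑ k ∈ s, ‖g k x‖ ^ 2
        rcases hS.eq_or_lt with h0 | h0
        · change S ≤ _
          rw [← h0]; positivity
        · have hsq : 0 < √S := Real.sqrt_pos.2 h0
          have h5 : √S ≤ C := by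
            refine le_of_mul_le_mul_right ?_ hsq
            rwa [Real.mul_self_sqrt hS]
          change S ≤ _
          rw [← Real.sq_sqrt hS]
          gcongr
    _ = C ^ 2 := by simp

lemma exists_finset_card_eq_threshold {ι : Type*} [Infinite ι] {a : ι → ℝ} (ha : ∀ k, 0 < a k)
    (hs : Summable a) (n : ℕ) :
    ∃ S : Finset ι, S.card = n ∧ ∃ t, 0 ≤ t ∧ (∀ k ∈ S, t ≤ a k) ∧ ∀ k ∉ S, a k ≤ t := by
  classical
  induction n with
  | zero =>
    exact ⟨∅, rfl, ∑' k, a k, tsum_nonneg fun k => (ha k).le, by simp,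
      fun k _ => hs.le_tsum k fun j _ => (ha j).le⟩
  | succ n ih =>
    obtain ⟨S, hcard, t, -, hS, hSc⟩ := ih
    obtain ⟨l, hl⟩ := Infinite.exists_notMem_finset S
    have hfin : {k | a l ≤ a k}.Finite := by
      have := hs.tendsto_cofinite_zero.eventually_lt_const (ha l)
      simpa [Filter.eventually_cofinite] using this
    obtain ⟨m, hm, hmax⟩ := (hfin.toFinset \ S).exists_max_image a ⟨l, by simp [hl]⟩
    simp only [Finset.mem_sdiff, Set.Finite.mem_toFinset, Set.mem_ofPred_eq, and_imp] at hm hmax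
    refine ⟨insert m S, by rw [Finset.card_insert_of_notMem hm.2, hcard], a m, (ha m).le, ?_, ?_⟩
    · intro k hk
      rcases Finset.mem_insert.1 hk with rfl | hk
      · exact le_rfl
      · exact (hSc m hm.2).trans (hS k hk)
    · intro k hk
      rw [Finset.mem_insert, not_or] at hk
      rcases le_total (a l) (a k) with h | h
      · exact hmax k h hk.2
      · exact h.trans hm.1

lemma sum_sdiff_le_sum_mul_one_sub {ι : Type*} [DecidableEq ι] {a p : ι → ℝ} {S s : Finset ι}
    (hSs : S ⊆ s) {t : ℝ} (ht : 0 ≤ t) (hS : ∀ k ∈ S, t ≤ a k) (hSc : ∀ k ∉ S, a k ≤ t)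
    (hp0 : ∀ k ∈ s, 0 ≤ p k) (hp1 : ∀ k ∈ s, p k ≤ 1) (hp : ∑ k ∈ s, p k ≤ S.card) :
    ∑ k ∈ s \ S, a k ≤ ∑ k ∈ s, a k * (1 - p k) := by
  rw [← Finset.sum_sdiff hSs] at hp ⊢
  have h1 : ∑ k ∈ S, t * (1 - p k) ≤ ∑ k ∈ S, a k * (1 - p k) :=
    Finset.sum_le_sum fun k hk =>
      mul_le_mul_of_nonneg_right (hS k hk) (sub_nonneg.2 (hp1 k (hSs hk)))
  have h2 : ∑ k ∈ s \ S, (a k - t * p k) ≤ ∑ k ∈ s \ S, a k * (1 - p k) :=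
    Finset.sum_le_sum fun k hk => by
      rw [Finset.mem_sdiff] at hk
      nlinarith [mul_le_mul_of_nonneg_right (hSc k hk.2) (hp0 k hk.1)]
  rw [← Finset.mul_sum, Finset.sum_sub_distrib] at h1
  rw [Finset.sum_sub_distrib, ← Finset.mul_sum] at h2
  simp only [Finset.sum_const, nsmul_eq_mul, mul_one] at h1
  nlinarith [mul_le_mul_of_nonneg_left hp ht]

lemma sum_norm_starProjection_sq_le {E ι : Type*} [NormedAddCommGroup E] [InnerProductSpace ℂ E]
    (R : Submodule ℂ E) [FiniteDimensional ℂ R] {e : ι → E} (he : Orthonormal ℂ e)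
    (s : Finset ι) :
    ∑ k ∈ s, ‖R.starProjection (e k)‖ ^ 2 ≤ Module.finrank ℂ R := by
  let u := stdOrthonormalBasis ℂ R
  have h1 : ∀ k, ‖R.starProjection (e k)‖ ^ 2 = ∑ i, ‖inner ℂ (e k) (u i : E)‖ ^ 2 := by
    intro k
    have h2 := u.sum_sq_norm_inner_right (R.orthogonalProjectionOnto (e k))
    rw [Submodule.starProjection_apply, ← Submodule.coe_norm, ← h2]
    refine Finset.sum_congr rfl fun i _ => ?_
    rw [Submodule.inner_orthogonalProjectionOnto_eq_of_mem_left, norm_inner_symm]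
  simp_rw [h1]
  rw [Finset.sum_comm]
  calc _ ≤ ∑ i, ‖(u i : E)‖ ^ 2 := Finset.sum_le_sum fun i _ =>
        he.sum_inner_products_le (u i : E)
    _ = _ := by
      have : ∀ i, ‖(u i : E)‖ = 1 := fun i => u.orthonormal.1 i
      simp [this]

lemma sq_mul_one_sub_le_norm_sub_sq {E : Type*} [NormedAddCommGroup E] [InnerProductSpace ℂ E]
    (R : Submodule ℂ E) [R.HasOrthogonalProjection] {e v : E} (he : ‖e‖ = 1) (hv : v ∈ R)
    (c : ℂ) : ‖c‖ ^ 2 * (1 - ‖R.starProjection e‖ ^ 2) ≤ ‖c • e - v‖ ^ 2 := by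
  have h0 : Rᗮ.starProjection v = 0 :=
    Rᗮ.starProjection_apply_eq_zero_iff.2 (R.le_orthogonal_orthogonal hv)
  have h1 := R.norm_sq_eq_add_norm_sq_starProjection e
  have h2 : ‖Rᗮ.starProjection (c • e - v)‖ = ‖c‖ * ‖Rᗮ.starProjection e‖ := by
    rw [map_sub, map_smul, h0, sub_zero, norm_smul]
  have h3 : 1 - ‖R.starProjection e‖ ^ 2 = ‖Rᗮ.starProjection e‖ ^ 2 := by
    rw [he] at h1; linarith
  rw [h3, ← mul_pow, ← h2]
  gcongr
  exact Rᗮ.norm_starProjection_apply_le _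

/-- The `k`-th Fourier coefficient as a linear functional on `L^∞(𝕋^d)`. -/
def fourierCoefLp {d : ℕ} (k : ZLat d) : Lp ℂ ⊤ (torusMeasure d) →ₗ[ℂ] ℂ where
  toFun f := fourierCoef f k
  map_add' f g := by
    have hint : ∀ f : Lp ℂ ⊤ (torusMeasure d),
        Integrable (fun x => (starRingEnd ℂ) (torusChar k x) * f x) (torusMeasure d) := by
      intro f
      refine ((Lp.memLp f).integrable le_top).bdd_mul (c := 1) ?_ ?_
      · exact (torusCharCM k).continuous.star.aestronglyMeasurable
      · exact .of_forall fun x => by simp [norm_torusChar]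
    rw [fourierCoef, fourierCoef, fourierCoef, ← integral_add (hint f) (hint g)]
    refine integral_congr_ae ?_
    filter_upwards [Lp.coeFn_add f g] with x hx
    rw [hx, Pi.add_apply, mul_add]
  map_smul' c f := by
    rw [fourierCoef, fourierCoef, RingHom.id_apply, smul_eq_mul, ← integral_const_mul]
    refine integral_congr_ae ?_
    filter_upwards [Lp.coeFn_smul c f] with x hx
    rw [hx, Pi.smul_apply, smul_eq_mul]
    ring

lemma sqrt_tsum_le_norm_sub {d : ℕ} {w : ZLat d → ℝ}
    {X : Type} [NormedAddCommGroup X] [NormedSpace ℂ X] {T : ellTwo d →L[ℂ] X}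
    (J : X →ₗ[ℂ] Lp ℂ ⊤ (torusMeasure d)) (hJ : ∀ x, ‖J x‖ ≤ ‖x‖)
    (hT : ∀ c k, fourierCoef (J (T c)) k = c k / (w k : ℂ))
    {S : Finset (ZLat d)} {t : ℝ} (ht : 0 ≤ t) (hS : ∀ k ∈ S, t ≤ (w k)⁻¹ ^ 2)
    (hSc : ∀ k ∉ S, (w k)⁻¹ ^ 2 ≤ t) {A : ellTwo d →L[ℂ] X}
    (hA : Module.rank ℂ (LinearMap.range (A : ellTwo d →ₗ[ℂ] X)) < (S.card + 1 : ℕ)) :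
    √(∑' k, if k ∈ S then 0 else (w k)⁻¹ ^ 2) ≤ ‖T - A‖ := by
  classical
  rw [Real.sqrt_le_left (norm_nonneg _)]
  refine Real.tsum_le_of_sum_le (fun k => by split_ifs <;> positivity) fun s₀ => ?_
  set s := s₀ ∪ S with hs
  have hSs : S ⊆ s := Finset.subset_union_right
  let Q : Lp ℂ ⊤ (torusMeasure d) →ₗ[ℂ] EuclideanSpace ℂ s :=
    (WithLp.linearEquiv 2 ℂ (s → ℂ)).symm.toLinearMap ∘ₗ
      LinearMap.pi fun k : s => fourierCoefLp (k : ZLat d)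
  have hQ : ∀ f k, Q f k = fourierCoef f k := fun f k => rfl
  have hQnorm : ∀ f, ‖Q f‖ ^ 2 ≤ ∫ x, ‖f x‖ ^ 2 ∂(torusMeasure d) := by
    intro f
    rw [EuclideanSpace.norm_sq_eq]
    simp only [hQ]
    rw [Finset.sum_coe_sort s (fun k => ‖fourierCoef f k‖ ^ 2)]
    exact sum_norm_fourierCoef_sq_le ((Lp.memLp f).mono_exponent le_top) s
  let A' : ellTwo d →ₗ[ℂ] EuclideanSpace ℂ s := (Q ∘ₗ J) ∘ₗ (A : ellTwo d →ₗ[ℂ] X)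
  set R := LinearMap.range A' with hR
  have hrank : Module.finrank ℂ R ≤ S.card := by
    have h1 := (LinearMap.rank_comp_le_right (A : ellTwo d →ₗ[ℂ] X) (Q ∘ₗ J)).trans_lt hA
    rw [LinearMap.rank, ← Module.finrank_eq_rank, Nat.cast_lt] at h1
    exact Nat.lt_succ_iff.1 h1
  let δ : ZLat d → ellTwo d := fun k => lp.single 2 k (1 : ℂ)
  let e : s → EuclideanSpace ℂ s := fun k => EuclideanSpace.single k (1 : ℂ)
  have he : Orthonormal ℂ e := EuclideanSpace.orthonormal_single
  let g : ZLat d → Lp ℂ ⊤ (torusMeasure d) := fun k => J ((T - A) (δ k))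
  have hg : ∀ k : s, Q (g k) = (((w k)⁻¹ : ℝ) : ℂ) • e k - A' (δ k) := by
    intro k
    have h1 : Q (J (T (δ k))) = (((w k)⁻¹ : ℝ) : ℂ) • e k := by
      ext l
      rw [hQ, hT]
      by_cases hkl : l = k
      · subst hkl
        simp [δ, e]
      · have : (l : ZLat d) ≠ k := fun h => hkl (Subtype.ext h)
        simp [δ, e, hkl, this]
    simp only [g, sub_apply, map_sub, h1]
    rfl
  let p : ZLat d → ℝ := fun k => if hk : k ∈ s then ‖R.starProjection (e ⟨k, hk⟩)‖ ^ 2 else 0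
  have hpe : ∀ k : s, p k = ‖R.starProjection (e k)‖ ^ 2 := fun k => by simp [p]
  calc ∑ k ∈ s₀, (if k ∈ S then 0 else (w k)⁻¹ ^ 2)
      ≤ ∑ k ∈ s, (if k ∈ S then 0 else (w k)⁻¹ ^ 2) :=
        Finset.sum_le_sum_of_subset_of_nonneg Finset.subset_union_left
          fun k _ _ => by split_ifs <;> positivity
    _ = ∑ k ∈ s \ S, (w k)⁻¹ ^ 2 := by
        rw [← Finset.sum_sdiff hSs, Finset.sum_eq_zero (s := S) fun k hk => if_pos hk, add_zero]
        exact Finset.sum_congr rfl fun k hk => if_neg (Finset.mem_sdiff.1 hk).2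
    _ ≤ ∑ k ∈ s, (w k)⁻¹ ^ 2 * (1 - p k) := by
        refine sum_sdiff_le_sum_mul_one_sub hSs ht hS hSc ?_ ?_ ?_
        · intro k hk
          rw [hpe ⟨k, hk⟩]; positivity
        · intro k hk
          rw [hpe ⟨k, hk⟩]
          refine pow_le_one₀ (norm_nonneg _) ?_
          exact (R.norm_starProjection_apply_le _).trans (he.1 _).le
        · rw [← Finset.sum_coe_sort s]
          simp only [hpe]
          exact (sum_norm_starProjection_sq_le R he Finset.univ).trans (by exact_mod_cast hrank)
    _ ≤ ∑ k ∈ s, ‖Q (g k)‖ ^ 2 := by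
        refine Finset.sum_le_sum fun k hk => ?_
        have h1 := sq_mul_one_sub_le_norm_sub_sq R (he.1 ⟨k, hk⟩)
          (LinearMap.mem_range_self A' (δ k)) (((w k)⁻¹ : ℝ) : ℂ)
        rwa [← hg ⟨k, hk⟩, ← hpe ⟨k, hk⟩, Complex.norm_real, Real.norm_eq_abs, sq_abs] at h1
    _ ≤ ∑ k ∈ s, ∫ x, ‖g k x‖ ^ 2 ∂(torusMeasure d) := Finset.sum_le_sum fun k _ => hQnorm _
    _ ≤ ‖T - A‖ ^ 2 := by
        refine sum_integral_norm_sq_le s g fun c => ?_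
        have h1 : ∑ k ∈ s, c k • g k = J ((T - A) (∑ k ∈ s, lp.single 2 k (c k))) := by
          simp only [map_sum, g, δ]
          refine Finset.sum_congr rfl fun k _ => ?_
          rw [← map_smul, ← map_smul, ← lp.single_smul, smul_eq_mul, mul_one]
        have h2 : ‖(∑ k ∈ s, lp.single 2 k (c k) : ellTwo d)‖ = √(∑ k ∈ s, ‖c k‖ ^ 2) := by
          have := lp.norm_sum_single (E := fun _ : ZLat d => ℂ) (p := 2) (by simp) c s
          simp only [ENNReal.toReal_ofNat, Real.rpow_ofNat] at this
          rw [← this, Real.sqrt_sq (norm_nonneg _)]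
        rw [h1, ← h2]
        exact (hJ _).trans (ContinuousLinearMap.le_opNorm _ _)

lemma summable_norm_mul_and_tsum_le {d : ℕ} (c : ellTwo d) {b : ZLat d → ℝ} (hb : ∀ k, 0 ≤ b k)
    (hs : Summable fun k => b k ^ 2) :
    (Summable fun k => ‖c k‖ * b k) ∧
      ∑' k, ‖c k‖ * b k ≤ ‖c‖ * √(∑' k, b k ^ 2) := by
  have h := Real.summable_and_inner_le_Lp_mul_Lq_tsum_of_nonneg (p := 2) (q := 2)
    (by exact Real.HolderConjugate.two_two) (fun k => norm_nonneg (c k)) hb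
    (by simpa using (lp.memℓp c).summable (by simp)) (by simpa using hs)
  refine ⟨h.1, h.2.trans_eq ?_⟩
  rw [lp.norm_eq_tsum_rpow (by simp) c, Real.sqrt_eq_rpow]
  simp

lemma summable_norm_div {d : ℕ} {w : ZLat d → ℝ} (hw : ∀ k, 0 < w k)
    (hsum : Summable fun k : ZLat d => (w k)⁻¹ ^ 2) (c : ellTwo d) :
    Summable fun k => ‖c k / (w k : ℂ)‖ := by
  have := (summable_norm_mul_and_tsum_le c (fun k => (inv_pos.2 (hw k)).le) hsum).1
  refine this.congr fun k => ?_
  rw [norm_div, Complex.norm_real, Real.norm_eq_abs, abs_of_pos (hw k), div_eq_mul_inv]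

lemma exists_rank_lt_norm_sub_le {d : ℕ} {w : ZLat d → ℝ} (hw : ∀ k, 0 < w k)
    (hsum : Summable fun k : ZLat d => (w k)⁻¹ ^ 2)
    {X : Type*} [NormedAddCommGroup X] [NormedSpace ℂ X] {T : ellTwo d →L[ℂ] X}
    (hT : ∀ c, ‖T c‖ ≤ ∑' k, ‖c k / (w k : ℂ)‖) (S : Finset (ZLat d)) :
    ∃ A : ellTwo d →L[ℂ] X,
      Module.rank ℂ (LinearMap.range (A : ellTwo d →ₗ[ℂ] X)) < (S.card + 1 : ℕ) ∧
      ‖T - A‖ ≤ √(∑' k, if k ∈ S then 0 else (w k)⁻¹ ^ 2) := by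
  classical
  let P : ellTwo d →L[ℂ] ellTwo d := ∑ k ∈ S,
    (lp.evalCLM ℂ (fun _ : ZLat d => ℂ) 2 k).smulRight (lp.single 2 k (1 : ℂ))
  have hP : ∀ c, P c = ∑ k ∈ S, lp.single 2 k (c k) := by
    intro c
    simp only [P, sum_apply]
    refine Finset.sum_congr rfl fun k _ => ?_
    rw [ContinuousLinearMap.smulRight_apply, ← lp.single_smul]
    simp [lp.evalCLM]
  have hPc : ∀ c l, (c - P c) l = if l ∈ S then 0 else c l := by
    intro c l
    rw [hP, lp.coeFn_sub, Pi.sub_apply, lp.coeFn_sum, Finset.sum_apply]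
    simp [Pi.single_apply]
    split_ifs <;> simp
  refine ⟨T.comp P, ?_, ?_⟩
  · have hle : LinearMap.range ((T.comp P : ellTwo d →L[ℂ] X) : ellTwo d →ₗ[ℂ] X) ≤
        Submodule.span ℂ (S.image fun k => T (lp.single 2 k (1 : ℂ)) : Finset X) := by
      rintro _ ⟨c, rfl⟩
      simp only [ContinuousLinearMap.coe_coe, ContinuousLinearMap.comp_apply, hP, map_sum]
      refine Submodule.sum_mem _ fun k hk => ?_
      have : (lp.single 2 k (c k) : ellTwo d) = c k • lp.single 2 k (1 : ℂ) := by
        rw [← lp.single_smul, smul_eq_mul, mul_one]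
      rw [this, map_smul]
      exact Submodule.smul_mem _ _ (Submodule.subset_span (by simpa using ⟨k, hk, rfl⟩))
    refine (Submodule.rank_mono hle).trans_lt ((rank_span_finset_le _).trans_lt ?_)
    exact_mod_cast Nat.lt_succ_of_le Finset.card_image_le
  · refine ContinuousLinearMap.opNorm_le_bound _ (Real.sqrt_nonneg _) fun c => ?_
    have hb2 : ∀ k, (if k ∈ S then 0 else (w k)⁻¹) ^ 2 = if k ∈ S then 0 else (w k)⁻¹ ^ 2 :=
      fun k => by split_ifs <;> simp
    have h := (summable_norm_mul_and_tsum_le c (b := fun k => if k ∈ S then 0 else (w k)⁻¹)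
      (fun k => by
        have := (inv_pos.2 (hw k)).le
        split_ifs <;> simp [this])
      (by
        simp only [hb2]
        refine Summable.of_nonneg_of_le (fun k => ?_) (fun k => ?_) hsum <;>
          split_ifs <;> first | positivity | exact le_rfl)).2
    simp only [hb2] at h
    rw [mul_comm]
    refine le_trans ?_ h
    have h1 : (T - T.comp P) c = T (c - P c) := by simp
    rw [h1]
    refine (hT _).trans_eq (tsum_congr fun k => ?_)
    rw [hPc, norm_div, Complex.norm_real, Real.norm_eq_abs, abs_of_pos (hw k)]
    split_ifs <;> simp [div_eq_mul_inv]

lemma approxNum_eq {d : ℕ} {w : ZLat d → ℝ} (hw : ∀ k, 0 < w k)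
    (hsum : Summable fun k : ZLat d => (w k)⁻¹ ^ 2)
    {X : Type} [NormedAddCommGroup X] [NormedSpace ℂ X] {T : ellTwo d →L[ℂ] X}
    (hT : ∀ c, ‖T c‖ ≤ ∑' k, ‖c k / (w k : ℂ)‖)
    (J : X →ₗ[ℂ] Lp ℂ ⊤ (torusMeasure d)) (hJ : ∀ x, ‖J x‖ ≤ ‖x‖)
    (hJT : ∀ c k, fourierCoef (J (T c)) k = c k / (w k : ℂ))
    {S : Finset (ZLat d)} {t : ℝ} (ht : 0 ≤ t) (hS : ∀ k ∈ S, t ≤ (w k)⁻¹ ^ 2)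
    (hSc : ∀ k ∉ S, (w k)⁻¹ ^ 2 ≤ t) :
    approxNum T (S.card + 1) = √(∑' k, if k ∈ S then 0 else (w k)⁻¹ ^ 2) := by
  obtain ⟨A, hA, hTA⟩ := exists_rank_lt_norm_sub_le hw hsum hT S
  have hbdd : BddBelow {c : ℝ | ∃ B : ellTwo d →L[ℂ] X,
      Module.rank ℂ (LinearMap.range (B : ellTwo d →ₗ[ℂ] X)) < (S.card + 1 : ℕ) ∧
        c = ‖T - B‖} :=
    ⟨0, by rintro _ ⟨B, -, rfl⟩; exact norm_nonneg _⟩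
  unfold approxNum
  refine le_antisymm ?_ ?_
  · exact (csInf_le hbdd ⟨A, hA, rfl⟩).trans hTA
  · refine le_csInf ⟨_, A, hA, rfl⟩ ?_
    rintro _ ⟨B, hB, rfl⟩
    exact sqrt_tsum_le_norm_sub J hJ hJT ht hS hSc hB

lemma ellOne_summable_norm {d : ℕ} (a : ellOne d) : Summable fun k => ‖a k‖ := by
  simpa using (lp.memℓp a).summable (by simp)

lemma norm_smul_torusCharCM_le {d : ℕ} (c : ℂ) (k : ZLat d) : ‖c • torusCharCM k‖ ≤ ‖c‖ := by
  rw [norm_smul]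
  exact mul_le_of_le_one_right (norm_nonneg _) (norm_torusCharCM_le k)

/-- The embedding of the Wiener algebra, modelled as `ℓ¹`, into `C(𝕋^d)`. -/
def wienerEmbedding (d : ℕ) : ellOne d →ₗ[ℂ] C(Torus d, ℂ) where
  toFun a := ∑' k, a k • torusCharCM k
  map_add' a b := by
    have hs : ∀ a : ellOne d, Summable fun k => a k • torusCharCM k := fun a =>
      .of_norm_bounded (ellOne_summable_norm a) fun k => norm_smul_torusCharCM_le (a k) k
    rw [← (hs a).tsum_add (hs b)]
    exact tsum_congr fun k => by rw [lp.coeFn_add, Pi.add_apply, add_smul]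
  map_smul' c a := by
    rw [RingHom.id_apply, ← tsum_const_smul'']
    exact tsum_congr fun k => by rw [lp.coeFn_smul, Pi.smul_apply, smul_assoc]

lemma ellOne_norm_eq {d : ℕ} (a : ellOne d) : ‖a‖ = ∑' k, ‖a k‖ := by
  simpa using lp.norm_eq_tsum_rpow (by simp) a

lemma norm_wienerEmbedding_le {d : ℕ} (a : ellOne d) : ‖wienerEmbedding d a‖ ≤ ‖a‖ := by
  rw [ellOne_norm_eq]
  exact tsum_of_norm_bounded (ellOne_summable_norm a).hasSum
    fun k => norm_smul_torusCharCM_le (a k) k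

lemma fourierCoefCLM_smul_torusCharCM {d : ℕ} (c : ℂ) (k l : ZLat d) :
    fourierCoefCLM k (c • torusCharCM l) = if k = l then c else 0 := by
  rw [map_smul, fourierCoefCLM_apply]
  change _ • fourierCoef (torusChar l) k = _
  simp [fourierCoef_torusChar]

lemma fourierCoef_wienerEmbedding {d : ℕ} (a : ellOne d) (k : ZLat d) :
    fourierCoef (wienerEmbedding d a) k = a k := by
  rw [← fourierCoefCLM_apply]
  change fourierCoefCLM k (∑' l, a l • torusCharCM l) = _
  rw [ContinuousLinearMap.map_tsum _ (.of_norm_bounded (ellOne_summable_norm a)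
    fun k => norm_smul_torusCharCM_le (a k) k)]
  simp only [fourierCoefCLM_smul_torusCharCM]
  rw [tsum_eq_single k fun l hl => if_neg hl.symm, if_pos rfl]

/-- The embedding of `C(𝕋^d)` into `L^∞(𝕋^d)`. -/
abbrev toLinfty (d : ℕ) : C(Torus d, ℂ) →ₗ[ℂ] Lp ℂ ⊤ (torusMeasure d) :=
  (ContinuousMap.toLp (E := ℂ) ⊤ (torusMeasure d) ℂ).toLinearMap

lemma norm_toLinfty_le {d : ℕ} (f : C(Torus d, ℂ)) : ‖toLinfty d f‖ ≤ ‖f‖ := by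
  refine (Lp.norm_le_of_ae_bound (C := ‖f‖) (norm_nonneg _) ?_).trans (by simp)
  filter_upwards [ContinuousMap.coeFn_toLp (p := ⊤) (𝕜 := ℂ) (torusMeasure d) f] with x hx
  exact (congrArg norm hx).trans_le (f.norm_coe_le_norm x)

lemma fourierCoef_toLinfty {d : ℕ} (f : C(Torus d, ℂ)) (k : ZLat d) :
    fourierCoef (toLinfty d f) k = fourierCoef f k := by
  refine integral_congr_ae ?_
  filter_upwards [ContinuousMap.coeFn_toLp (p := ⊤) (𝕜 := ℂ) (torusMeasure d) f] with x hx
  exact congrArg _ hx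

section Dyadic

variable {d : ℕ} {ψ : (Fin d → ℝ) → ℝ}

lemma dyadicPhi_nonneg (hψnonneg : ∀ ξ, 0 ≤ ψ ξ) (hψmono : ∀ ξ, ψ ξ ≤ ψ ((2 : ℝ)⁻¹ • ξ))
    (j : ℕ) (ξ : Fin d → ℝ) : 0 ≤ dyadicPhi ψ j ξ := by
  cases j with
  | zero => exact hψnonneg ξ
  | succ j =>
    have := hψmono (((2 : ℝ)⁻¹ ^ j) • ξ)
    rw [smul_smul, ← pow_succ'] at this
    exact sub_nonneg.2 this

lemma sum_range_dyadicPhi (N : ℕ) (ξ : Fin d → ℝ) :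
    ∑ j ∈ Finset.range (N + 1), dyadicPhi ψ j ξ = ψ (((2 : ℝ)⁻¹ ^ N) • ξ) := by
  induction N with
  | zero => simp [dyadicPhi]
  | succ N ih => rw [Finset.sum_range_succ, ih]; simp [dyadicPhi]

lemma hasSum_dyadicPhi (hψone : ∀ ξ : Fin d → ℝ, ∑ j, ξ j ^ 2 ≤ 1 → ψ ξ = 1)
    (hψnonneg : ∀ ξ, 0 ≤ ψ ξ) (hψmono : ∀ ξ, ψ ξ ≤ ψ ((2 : ℝ)⁻¹ • ξ)) (ξ : Fin d → ℝ) :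
    HasSum (fun j => dyadicPhi ψ j ξ) 1 := by
  rw [hasSum_iff_tendsto_nat_of_nonneg fun j => dyadicPhi_nonneg hψnonneg hψmono j ξ,
    ← tendsto_add_atTop_iff_nat 1]
  have hlim : Tendsto (fun N : ℕ => ∑ i, (((2 : ℝ)⁻¹ ^ N) • ξ) i ^ 2) atTop (nhds 0) := by
    have h1 : Tendsto (fun N : ℕ => ((2 : ℝ)⁻¹ ^ N)) atTop (nhds 0) :=
      tendsto_pow_atTop_nhds_zero_of_lt_one (by norm_num) (by norm_num)
    have h2 := tendsto_finsetSum Finset.univ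
      fun (i : Fin d) _ => (h1.mul_const (ξ i)).pow 2
    simpa using h2
  refine tendsto_const_nhds.congr' ?_
  filter_upwards [hlim.eventually_le_const zero_lt_one] with N hN
  rw [sum_range_dyadicPhi, hψone _ hN]

lemma finite_dyadicPhi_ne_zero
    (hψsupp : ∀ ξ : Fin d → ℝ, (3 / 2 : ℝ) ^ 2 < ∑ j, ξ j ^ 2 → ψ ξ = 0) (j : ℕ) :
    {k : ZLat d | dyadicPhi ψ j (fun i => (k i : ℝ)) ≠ 0}.Finite := by
  have hscale : ∀ N : ℕ, {k : ZLat d | ψ (((2 : ℝ)⁻¹ ^ N) • fun i => (k i : ℝ)) ≠ 0}.Finite := by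
    intro N
    refine (Set.finite_Icc (fun _ => -(2 * 2 ^ N) : ZLat d) fun _ => 2 * 2 ^ N).subset ?_
    intro k hk
    have hk' : ∑ i, (((2 : ℝ)⁻¹ ^ N) * (k i : ℝ)) ^ 2 ≤ (3 / 2) ^ 2 := by
      by_contra! h
      exact hk (hψsupp _ h)
    have habs : ∀ i, |k i| ≤ 2 * 2 ^ N := by
      intro i
      have h1 := (Finset.single_le_sum (f := fun i => (((2 : ℝ)⁻¹ ^ N) * (k i : ℝ)) ^ 2)
        (fun i _ => sq_nonneg _) (Finset.mem_univ i)).trans hk'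
      have h2 := abs_le_of_sq_le_sq h1 (by norm_num)
      rw [abs_mul, abs_of_pos (by positivity), inv_pow, inv_mul_le_iff₀ (by positivity)] at h2
      have h3 : |(k i : ℝ)| ≤ 2 * 2 ^ N := by
        have : (0 : ℝ) < 2 ^ N := by positivity
        linarith
      exact_mod_cast h3
    exact Set.mem_Icc.2 ⟨fun i => (abs_le.1 (habs i)).1, fun i => (abs_le.1 (habs i)).2⟩
  cases j with
  | zero => simpa [dyadicPhi] using hscale 0
  | succ j =>
    refine ((hscale (j + 1)).union (hscale j)).subset fun k hk => ?_
    by_contra h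
    simp only [Set.mem_union, Set.mem_ofPred_eq, not_or, not_not] at h
    exact hk (by simp only [dyadicPhi]; rw [h.1, h.2, sub_zero])

lemma iSup_norm_dyadicBlock_le {f : Torus d → ℂ} (hs : Summable fun k => ‖fourierCoef f k‖)
    (hψone : ∀ ξ : Fin d → ℝ, ∑ j, ξ j ^ 2 ≤ 1 → ψ ξ = 1)
    (hψnonneg : ∀ ξ, 0 ≤ ψ ξ) (hψmono : ∀ ξ, ψ ξ ≤ ψ ((2 : ℝ)⁻¹ • ξ)) :
    ∑' j, ⨆ x, ‖dyadicBlock ψ f j x‖ ≤ ∑' k, ‖fourierCoef f k‖ := by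
  have hsum := fun k : ZLat d => hasSum_dyadicPhi hψone hψnonneg hψmono fun i => (k i : ℝ)
  have hnn := fun j (k : ZLat d) => dyadicPhi_nonneg hψnonneg hψmono j fun i => (k i : ℝ)
  have hφs : ∀ j, Summable fun k : ZLat d =>
      dyadicPhi ψ j (fun i => (k i : ℝ)) * ‖fourierCoef f k‖ := fun j =>
    .of_nonneg_of_le (fun k => mul_nonneg (hnn j k) (norm_nonneg _))
      (fun k => mul_le_of_le_one_left (norm_nonneg _)
        (le_hasSum (hsum k) j fun i _ => hnn i k)) hs
  have hblock : ∀ j, ⨆ x, ‖dyadicBlock ψ f j x‖ ≤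
      ∑' k : ZLat d, dyadicPhi ψ j (fun i => (k i : ℝ)) * ‖fourierCoef f k‖ := fun j =>
    ciSup_le fun x => tsum_of_norm_bounded (hφs j).hasSum fun k => by
      rw [norm_mul, norm_mul, norm_torusChar, mul_one, Complex.norm_real, Real.norm_eq_abs,
        abs_of_nonneg (hnn j k)]
  refine Real.tsum_le_of_sum_range_le (fun j => Real.iSup_nonneg fun x => norm_nonneg _) fun N => ?_
  refine (Finset.sum_le_sum fun j _ => hblock j).trans ?_
  rw [← Summable.tsum_finsetSum fun j _ => hφs j]
  refine (summable_sum fun j _ => hφs j).tsum_le_tsum (fun k => ?_) hs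
  rw [← Finset.sum_mul]
  exact mul_le_of_le_one_left (norm_nonneg _) (sum_le_hasSum _ (fun j _ => hnn j k) (hsum k))

lemma norm_le_tsum_iSup_dyadicBlock {f : C(Torus d, ℂ)}
    (hs : Summable fun j => ⨆ x, ‖dyadicBlock ψ f j x‖)
    (hψsupp : ∀ ξ : Fin d → ℝ, (3 / 2 : ℝ) ^ 2 < ∑ j, ξ j ^ 2 → ψ ξ = 0)
    (hψone : ∀ ξ : Fin d → ℝ, ∑ j, ξ j ^ 2 ≤ 1 → ψ ξ = 1)
    (hψnonneg : ∀ ξ, 0 ≤ ψ ξ) (hψmono : ∀ ξ, ψ ξ ≤ ψ ((2 : ℝ)⁻¹ • ξ)) :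
    ‖f‖ ≤ ∑' j, ⨆ x, ‖dyadicBlock ψ f j x‖ := by
  classical
  let K : ℕ → Finset (ZLat d) := fun j => (finite_dyadicPhi_ne_zero hψsupp j).toFinset
  let a : ℕ → ZLat d → ℂ := fun j k =>
    (dyadicPhi ψ j (fun i => (k i : ℝ)) : ℂ) * fourierCoef f k
  have ha : ∀ j, ∀ k ∉ K j, a j k = 0 := fun j k hk => by
    have : dyadicPhi ψ j (fun i => (k i : ℝ)) = 0 := by simpa [K] using hk
    simp [a, this]
  let F : ℕ → C(Torus d, ℂ) := fun j => ∑ k ∈ K j, a j k • torusCharCM k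
  have hF : ∀ j x, dyadicBlock ψ f j x = F j x := by
    intro j x
    simp only [F, ContinuousMap.sum_apply, ContinuousMap.smul_apply, smul_eq_mul]
    exact tsum_eq_sum fun k hk => by
      change a j k * _ = 0
      rw [ha j k hk, zero_mul]
  have hFnorm : ∀ j, ⨆ x, ‖dyadicBlock ψ f j x‖ = ‖F j‖ := fun j => by
    simp only [hF, ContinuousMap.norm_eq_iSup_norm]
  have hFcoef : ∀ j k, fourierCoefCLM k (F j) = a j k := by
    intro j k
    simp only [F, map_sum, fourierCoefCLM_smul_torusCharCM, Finset.sum_ite_eq]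
    split_ifs with h
    · rfl
    · exact (ha j k h).symm
  simp only [hFnorm] at hs ⊢
  have hf : f = ∑' j, F j := by
    refine continuousMap_eq_of_fourierCoef_eq fun k => ?_
    rw [← fourierCoefCLM_apply k (∑' j, F j), ContinuousLinearMap.map_tsum _ hs.of_norm]
    simp only [hFcoef, a]
    have h1 := (hasSum_dyadicPhi hψone hψnonneg hψmono fun i => (k i : ℝ)).mapL Complex.ofRealCLM
    have h2 := (h1.mul_right (fourierCoef f k)).tsum_eq
    simpa using h2.symm
  calc ‖f‖ = ‖∑' j, F j‖ := congrArg norm hf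
    _ ≤ ∑' j, ‖F j‖ := norm_tsum_le_tsum_norm hs

end Dyadic

/-- Corollary 6 of Cobos–Kühn–Sickel. Let `w` satisfy
`∑_k w(k)^{-2} < ∞` and let `ψ` generate a smooth dyadic decomposition of unity on
`ℝ^d`.  Let `Y` be (an isometric copy of) the Besov space `B⁰_{∞,1}(𝕋^d)`, realized by
an injective linear map `ι : Y → C(𝕋^d)` which is norm-preserving for the Besov norm
`∑_j ‖f_j‖_∞` and onto the set of continuous functions with finite Besov norm.  Then
the approximation numbers of the embeddings of `F_d(w)` into `B⁰_{∞,1}(𝕋^d)`,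
`L_∞(𝕋^d)`, `C(𝕋^d)` and the Wiener algebra `A(𝕋^d)` (the latter modelled as `ℓ¹`)
all coincide. -/
theorem statement13 (d : ℕ) (hd : 0 < d) (w : ZLat d → ℝ) (hw : ∀ k, 0 < w k)
    (hsum : Summable fun k : ZLat d => (w k)⁻¹ ^ 2)
    (ψ : (Fin d → ℝ) → ℝ)
    (hψsmooth : ContDiff ℝ (⊤ : ℕ∞) ψ)
    (hψsupp : ∀ ξ : Fin d → ℝ, (3 / 2 : ℝ) ^ 2 < ∑ j, ξ j ^ 2 → ψ ξ = 0)
    (hψone : ∀ ξ : Fin d → ℝ, ∑ j, ξ j ^ 2 ≤ 1 → ψ ξ = 1)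
    (hψnonneg : ∀ ξ, 0 ≤ ψ ξ)
    (hψmono : ∀ ξ, ψ ξ ≤ ψ ((2 : ℝ)⁻¹ • ξ))
    (Y : Type) [NormedAddCommGroup Y] [NormedSpace ℂ Y]
    (ι : Y →ₗ[ℂ] C(Torus d, ℂ)) (hι_inj : Function.Injective ι)
    (hι_norm : ∀ y : Y, ‖y‖ = ∑' j : ℕ, ⨆ x : Torus d, ‖dyadicBlock ψ (⇑(ι y)) j x‖)
    (hι_surj : ∀ g : C(Torus d, ℂ),
      Summable (fun j : ℕ => ⨆ x : Torus d, ‖dyadicBlock ψ (⇑g) j x‖) → ∃ y, ι y = g)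
    (TB : ellTwo d →L[ℂ] Y)
    (hTB : ∀ (c : ellTwo d) (k : ZLat d), fourierCoef (⇑(ι (TB c))) k = c k / (w k : ℂ))
    (Ti : ellTwo d →L[ℂ] Lp ℂ ⊤ (torusMeasure d))
    (hTi : ∀ (c : ellTwo d) (k : ZLat d), fourierCoef (⇑(Ti c)) k = c k / (w k : ℂ))
    (TC : ellTwo d →L[ℂ] C(Torus d, ℂ))
    (hTC : ∀ (c : ellTwo d) (k : ZLat d), fourierCoef (⇑(TC c)) k = c k / (w k : ℂ))
    (TA : ellTwo d →L[ℂ] ellOne d)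
    (hTA : ∀ (c : ellTwo d) (k : ZLat d), TA c k = c k / (w k : ℂ)) :
    ∀ n : ℕ,
      approxNum TB (n + 1) = approxNum Ti (n + 1) ∧
      approxNum Ti (n + 1) = approxNum TC (n + 1) ∧
      approxNum TC (n + 1) = approxNum TA (n + 1) := by
  intro n
  have : Nonempty (Fin d) := ⟨⟨0, hd⟩⟩
  obtain ⟨S, rfl, t, ht, hS, hSc⟩ := exists_finset_card_eq_threshold
    (fun k => pow_pos (inv_pos.2 (hw k)) 2) hsum n
  have hcs := summable_norm_div hw hsum
  have hιle : ∀ y, ‖ι y‖ ≤ ‖y‖ := by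
    intro y
    by_cases hy : Summable fun j : ℕ => ⨆ x : Torus d, ‖dyadicBlock ψ (⇑(ι y)) j x‖
    · rw [hι_norm y]
      exact norm_le_tsum_iSup_dyadicBlock hy hψsupp hψone hψnonneg hψmono
    · have h0 : ‖y‖ = 0 := by rw [hι_norm y, tsum_eq_zero_of_not_summable hy]
      rw [norm_eq_zero.1 h0, map_zero, norm_zero, norm_zero]
  have hB := approxNum_eq hw hsum (T := TB)
    (fun c => by
      have h := iSup_norm_dyadicBlock_le (f := ι (TB c)) (by simpa only [hTB] using hcs c)
        hψone hψnonneg hψmono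
      rw [hι_norm]
      simpa only [hTB] using h)
    (toLinfty d ∘ₗ ι) (fun y => (norm_toLinfty_le _).trans (hιle y))
    (fun c k => (fourierCoef_toLinfty _ k).trans (hTB c k)) ht hS hSc
  have hi := approxNum_eq hw hsum (T := Ti)
    (fun c => by
      simpa only [hTi] using
        Lp_norm_le_tsum_norm_fourierCoef (f := Ti c) (by simpa only [hTi] using hcs c))
    LinearMap.id (fun _ => le_rfl) hTi ht hS hSc
  have hC := approxNum_eq hw hsum (T := TC)
    (fun c => by
      simpa only [hTC] using
        norm_le_tsum_norm_fourierCoef (f := TC c) (by simpa only [hTC] using hcs c))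
    (toLinfty d) norm_toLinfty_le (fun c k => (fourierCoef_toLinfty _ k).trans (hTC c k))
    ht hS hSc
  have hA := approxNum_eq hw hsum (T := TA)
    (fun c => by simpa only [hTA] using (ellOne_norm_eq (TA c)).le)
    (toLinfty d ∘ₗ wienerEmbedding d)
    (fun a => (norm_toLinfty_le _).trans (norm_wienerEmbedding_le a))
    (fun c k => (fourierCoef_toLinfty _ k).trans
      ((fourierCoef_wienerEmbedding _ k).trans (hTA c k))) ht hS hSc
  exact ⟨hB.trans hi.symm, hi.trans hC.symm, hC.trans hA.symm⟩
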